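/- arXiv:1602.05093 — 2 statements merged into one kernel-verified Lean document; each statement's English description precedes it below -/
import Mathlib

section
/- Tame product estimate for weighted sequence norms (Lemma 2.1, Fourier form): Let d ≥ 1 and s ≥ s₀ be real. There exists a constant C = C(s, d) > 0 such that for all u, v : ℤ^d → ℂ with ‖u‖_s < ∞ and ‖v‖_s < ∞, the convolution satisfies ‖u ⋆ v‖_s ≤ C (‖u‖_s ‖v‖_{s₀} + ‖u‖_{s₀} ‖v‖_s). -/
open scoped BigOperators

/-- The weighted (Fourier side) Sobolev norm `‖u‖_s` on sequences indexed by `ℤ^d`: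
`(∑ₖ ⟨k⟩^{2s} |u k|²)^{1/2}` with `⟨k⟩ = max(1, ‖k‖_∞)`. -/
noncomputable def wnorm {d : ℕ} (s : ℝ) (u : (Fin d → ℤ) → ℂ) : ℝ :=
  Real.sqrt (∑' k : Fin d → ℤ, (max 1 ‖k‖) ^ (2 * s) * ‖u k‖ ^ 2)

/-- Finiteness of `‖u‖_s`, expressed as summability of the weighted squares. -/
def WSummable {d : ℕ} (s : ℝ) (u : (Fin d → ℤ) → ℂ) : Prop :=
  Summable (fun k : Fin d → ℤ => (max 1 ‖k‖) ^ (2 * s) * ‖u k‖ ^ 2)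

/-- Convolution of sequences on `ℤ^d`. -/
noncomputable def conv {d : ℕ} (u v : (Fin d → ℤ) → ℂ) : (Fin d → ℤ) → ℂ :=
  fun k => ∑' k' : Fin d → ℤ, u (k - k') * v k'

open scoped ENNReal

/-- Weighted Cauchy–Schwarz inequality for sums in `ℝ≥0∞`. -/
theorem ENNReal.tsum_mul_sq_le {ι : Type*} (f g : ι → ℝ≥0∞) :
    (∑' i, f i * g i) ^ 2 ≤ (∑' i, f i ^ 2 * g i) * ∑' i, g i := by
  have amgm (a b : ℝ≥0∞) : 2 * (a * b) ≤ a ^ 2 + b ^ 2 := by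
    rcases eq_or_ne a ∞ with rfl | ha
    · simp
    rcases eq_or_ne b ∞ with rfl | hb
    · simp
    lift a to NNReal using ha
    lift b to NNReal using hb
    norm_cast
    simpa [mul_assoc] using two_mul_le_add_sq a b
  have expand (p q : ι → ℝ≥0∞) : (∑' i, p i) * ∑' j, q j = ∑' i, ∑' j, p i * q j := by
    simp_rw [ENNReal.tsum_mul_left, ENNReal.tsum_mul_right]
  have key : 2 * (∑' i, f i * g i) ^ 2 ≤ 2 * ((∑' i, f i ^ 2 * g i) * ∑' i, g i) := by
    calc 2 * (∑' i, f i * g i) ^ 2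
        = ∑' i, ∑' j, 2 * (f i * f j) * (g i * g j) := by
          rw [sq, expand]
          simp_rw [← ENNReal.tsum_mul_left]
          exact tsum_congr fun i => tsum_congr fun j => by ring
      _ ≤ ∑' i, ∑' j, (f i ^ 2 + f j ^ 2) * (g i * g j) := by
          gcongr with i j
          exact amgm _ _
      _ = (∑' i, f i ^ 2 * g i) * (∑' i, g i) + (∑' i, g i) * ∑' i, f i ^ 2 * g i := by
          rw [expand, expand]
          simp_rw [← ENNReal.tsum_add]
          exact tsum_congr fun i => tsum_congr fun j => by ring
      _ = 2 * ((∑' i, f i ^ 2 * g i) * ∑' i, g i) := by ring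
  exact (ENNReal.mul_le_mul_iff_right two_ne_zero ENNReal.ofNat_ne_top).1 key

/-- Young's inequality `‖f ⋆ g‖₂ ≤ ‖f‖₂ ‖g‖₁`, squared, for sums in `ℝ≥0∞`. -/
theorem ENNReal.tsum_conv_sq_le {G : Type*} [AddCommGroup G] (f g : G → ℝ≥0∞) :
    ∑' k, (∑' j, f (k - j) * g j) ^ 2 ≤ (∑' k, f k ^ 2) * (∑' j, g j) ^ 2 := by
  calc ∑' k, (∑' j, f (k - j) * g j) ^ 2
      ≤ ∑' k, (∑' j, f (k - j) ^ 2 * g j) * ∑' j, g j :=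
        ENNReal.tsum_le_tsum fun k => ENNReal.tsum_mul_sq_le (fun j => f (k - j)) g
    _ = (∑' j, ∑' k, f (k - j) ^ 2 * g j) * ∑' j, g j := by
        rw [ENNReal.tsum_mul_right, ENNReal.tsum_comm]
    _ = (∑' j, (∑' k, f k ^ 2) * g j) * ∑' j, g j := by
        congr 1
        refine tsum_congr fun j => ?_
        rw [ENNReal.tsum_mul_right, ← (Equiv.subRight j).tsum_eq fun k => f k ^ 2]
        rfl
    _ = _ := by rw [ENNReal.tsum_mul_left]; ring

section Weight

variable {d : ℕ}

/-- The weight `⟨k⟩ = max(1, ‖k‖_∞)` as an extended nonnegative real. -/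
noncomputable def eweight (k : Fin d → ℤ) : ℝ≥0∞ :=
  ENNReal.ofReal (max 1 ‖k‖)

/-- The square of the weighted norm, as an extended nonnegative real. -/
noncomputable def wenergy (s : ℝ) (u : (Fin d → ℤ) → ℂ) : ℝ≥0∞ :=
  ∑' k, eweight k ^ (2 * s) * ‖u k‖ₑ ^ 2

theorem one_le_eweight (k : Fin d → ℤ) : 1 ≤ eweight k := by
  simp [eweight]

theorem eweight_ne_zero (k : Fin d → ℤ) : eweight k ≠ 0 :=
  (zero_lt_one.trans_le (one_le_eweight k)).ne'

theorem eweight_ne_top (k : Fin d → ℤ) : eweight k ≠ ∞ :=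
  ENNReal.ofReal_ne_top

theorem eweight_rpow (k : Fin d → ℤ) (p : ℝ) :
    eweight k ^ p = ENNReal.ofReal ((max 1 ‖k‖) ^ p) :=
  ENNReal.ofReal_rpow_of_pos (by positivity)

theorem eweight_le_add (k j : Fin d → ℤ) : eweight k ≤ eweight (k - j) + eweight j := by
  rw [eweight, eweight, eweight, ← ENNReal.ofReal_add (by positivity) (by positivity)]
  refine ENNReal.ofReal_le_ofReal (max_le ?_ ?_)
  · linarith [le_max_left 1 ‖k - j‖, le_max_left 1 ‖j‖]
  · have h : ‖k‖ ≤ ‖k - j‖ + ‖j‖ := by simpa using norm_add_le (k - j) j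
    linarith [le_max_right 1 ‖k - j‖, le_max_right 1 ‖j‖]

theorem eweight_rpow_le {s : ℝ} (hs : 0 ≤ s) (k j : Fin d → ℤ) :
    eweight k ^ s ≤ 2 ^ s * (eweight (k - j) ^ s + eweight j ^ s) :=
  (ENNReal.rpow_le_rpow (eweight_le_add k j) hs).trans
    (ENNReal.add_rpow_le_two_rpow_mul_rpow_add_rpow _ _ hs)

theorem eweight_mul_enorm_sq (s : ℝ) (u : (Fin d → ℤ) → ℂ) (k : Fin d → ℤ) :
    eweight k ^ (2 * s) * ‖u k‖ₑ ^ 2 =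
      ENNReal.ofReal ((max 1 ‖k‖) ^ (2 * s) * ‖u k‖ ^ 2) := by
  rw [ENNReal.ofReal_mul (by positivity), eweight_rpow, ENNReal.ofReal_pow (norm_nonneg _),
    ofReal_norm]

theorem eweight_rpow_mul_sq (s : ℝ) (k : Fin d → ℤ) (x : ℝ≥0∞) :
    (eweight k ^ s * x) ^ 2 = eweight k ^ (2 * s) * x ^ 2 := by
  rw [mul_pow, ← ENNReal.rpow_natCast (eweight k ^ s), ← ENNReal.rpow_mul, Nat.cast_ofNat,
    mul_comm s]

theorem wnorm_eq_sqrt_wenergy (s : ℝ) (u : (Fin d → ℤ) → ℂ) :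
    wnorm s u = √(wenergy s u).toReal := by
  simp_rw [wnorm, wenergy, eweight_mul_enorm_sq]
  rw [ENNReal.tsum_toReal_eq fun _ => ENNReal.ofReal_ne_top]
  congr 1
  exact tsum_congr fun k => (ENNReal.toReal_ofReal (by positivity)).symm

theorem WSummable.wenergy_ne_top {s : ℝ} {u : (Fin d → ℤ) → ℂ} (h : WSummable s u) :
    wenergy s u ≠ ∞ := by
  simp_rw [wenergy, eweight_mul_enorm_sq]
  exact Summable.tsum_ofReal_ne_top h

theorem wenergy_mono {r s : ℝ} (h : r ≤ s) (u : (Fin d → ℤ) → ℂ) :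
    wenergy r u ≤ wenergy s u := by
  unfold wenergy
  gcongr with k
  exact one_le_eweight k

theorem summable_norm_inv_pow_pi_int {n : ℕ} (hn : d < n) :
    Summable fun k : Fin d → ℤ => ‖k‖⁻¹ ^ n := by
  let b := Pi.basisFun ℝ (Fin d)
  let L := Submodule.span ℤ (Set.range b)
  have hrank : Module.finrank ℤ L = d := by
    rw [ZLattice.rank ℝ L]
    simp
  have hmem (k : Fin d → ℤ) : (fun i => (k i : ℝ)) ∈ L := by
    refine (b.mem_span_iff_repr_mem ℤ _).2 ?_
    intro i
    exact ⟨k i, by simp [b]⟩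
  have hinj : Function.Injective fun k : Fin d → ℤ => (⟨fun i => (k i : ℝ), hmem k⟩ : L) := by
    intro k l h
    ext i
    have hi : (k i : ℝ) = l i := congrFun (congrArg Subtype.val h) i
    exact_mod_cast hi
  refine ((ZLattice.summable_norm_pow_inv L n (by omega)).comp_injective hinj).congr fun k => ?_
  have : ‖fun i => (k i : ℝ)‖ = ‖k‖ := by
    simp [Pi.norm_def, ← Int.norm_cast_real, nnnorm]
  simp [this]

theorem tsum_eweight_rpow_neg_ne_top {p : ℝ} {n : ℕ} (hn : d < n) (hp : n ≤ p) :
    ∑' k : Fin d → ℤ, eweight k ^ (-p) ≠ ∞ := by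
  simp_rw [eweight_rpow]
  refine Summable.tsum_ofReal_ne_top ?_
  refine (summable_norm_inv_pow_pi_int hn).of_norm_bounded_eventually ?_
  filter_upwards [(Set.finite_singleton (0 : Fin d → ℤ)).compl_mem_cofinite] with k hk
  have hk1 : 1 ≤ ‖k‖ := by
    obtain ⟨i, hi⟩ := Function.ne_iff.1 hk
    refine le_trans ?_ (norm_le_pi_norm k i)
    rw [Int.norm_eq_abs]
    exact_mod_cast Int.one_le_abs hi
  rw [max_eq_right hk1, Real.norm_of_nonneg (by positivity), inv_pow, ← Real.rpow_natCast,
    ← Real.rpow_neg (norm_nonneg k)]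
  exact Real.rpow_le_rpow_of_exponent_le hk1 (by linarith)

theorem tsum_enorm_sq_le (r : ℝ) (u : (Fin d → ℤ) → ℂ) :
    (∑' k, ‖u k‖ₑ) ^ 2 ≤ (∑' k : Fin d → ℤ, eweight k ^ (-(2 * r))) * wenergy r u := by
  have cancel (k : Fin d → ℤ) : eweight k ^ (2 * r) * eweight k ^ (-(2 * r)) = 1 := by
    rw [← ENNReal.rpow_add _ _ (eweight_ne_zero k) (eweight_ne_top k), add_neg_cancel,
      ENNReal.rpow_zero]
  have h := ENNReal.tsum_mul_sq_le (fun k => eweight k ^ (2 * r) * ‖u k‖ₑ)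
    fun k : Fin d → ℤ => eweight k ^ (-(2 * r))
  have h1 (k : Fin d → ℤ) :
      eweight k ^ (2 * r) * ‖u k‖ₑ * eweight k ^ (-(2 * r)) = ‖u k‖ₑ := by
    rw [mul_right_comm, cancel, one_mul]
  have h2 (k : Fin d → ℤ) : (eweight k ^ (2 * r) * ‖u k‖ₑ) ^ 2 * eweight k ^ (-(2 * r)) =
      eweight k ^ (2 * r) * ‖u k‖ₑ ^ 2 := by
    calc _ = eweight k ^ (2 * r) * ‖u k‖ₑ ^ 2 *
          (eweight k ^ (2 * r) * eweight k ^ (-(2 * r))) := by ring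
      _ = _ := by rw [cancel, mul_one]
  simp_rw [h1, h2] at h
  rwa [mul_comm]

theorem eweight_mul_enorm_conv_le {s : ℝ} (hs : 0 ≤ s) (u v : (Fin d → ℤ) → ℂ)
    (k : Fin d → ℤ) :
    eweight k ^ s * ‖conv u v k‖ₑ ≤
      2 ^ s * (∑' j, eweight (k - j) ^ s * ‖u (k - j)‖ₑ * ‖v j‖ₑ +
        ∑' j, eweight (k - j) ^ s * ‖v (k - j)‖ₑ * ‖u j‖ₑ) := by
  have swap : ∑' j, eweight (k - j) ^ s * ‖v (k - j)‖ₑ * ‖u j‖ₑ =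
      ∑' j, eweight j ^ s * ‖v j‖ₑ * ‖u (k - j)‖ₑ := by
    rw [← (Equiv.subLeft k).tsum_eq]
    simp
  rw [swap, ← ENNReal.tsum_add, ← ENNReal.tsum_mul_left]
  calc eweight k ^ s * ‖conv u v k‖ₑ
      ≤ eweight k ^ s * ∑' j, ‖u (k - j) * v j‖ₑ := by
        gcongr
        exact enorm_tsum_le_tsum_enorm
    _ = ∑' j, eweight k ^ s * (‖u (k - j)‖ₑ * ‖v j‖ₑ) := by
        simp_rw [enorm_mul, ENNReal.tsum_mul_left]
    _ ≤ _ := by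
        refine ENNReal.tsum_le_tsum fun j => ?_
        refine (mul_le_mul_left (eweight_rpow_le hs k j) _).trans_eq ?_
        ring

theorem wenergy_conv_le {s : ℝ} (hs : 0 ≤ s) (r : ℝ) (u v : (Fin d → ℤ) → ℂ) :
    wenergy s (conv u v) ≤
      2 * (2 ^ s) ^ 2 * (∑' k : Fin d → ℤ, eweight k ^ (-(2 * r))) *
        (wenergy s u * wenergy r v + wenergy r u * wenergy s v) := by
  have add_sq_le (a b : ℝ≥0∞) : (a + b) ^ 2 ≤ 2 * (a ^ 2 + b ^ 2) := by
    have h := ENNReal.rpow_add_le_mul_rpow_add_rpow a b one_le_two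
    norm_num at h
    exact h
  have young (f g : (Fin d → ℤ) → ℂ) :
      ∑' k, (∑' j, eweight (k - j) ^ s * ‖f (k - j)‖ₑ * ‖g j‖ₑ) ^ 2 ≤
        wenergy s f * ((∑' k : Fin d → ℤ, eweight k ^ (-(2 * r))) * wenergy r g) := by
    refine (ENNReal.tsum_conv_sq_le (fun k => eweight k ^ s * ‖f k‖ₑ) fun k => ‖g k‖ₑ).trans ?_
    simp_rw [eweight_rpow_mul_sq]
    exact mul_le_mul_right (tsum_enorm_sq_le r g) _
  calc wenergy s (conv u v)
      = ∑' k, (eweight k ^ s * ‖conv u v k‖ₑ) ^ 2 := by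
        simp_rw [eweight_rpow_mul_sq, wenergy]
    _ ≤ ∑' k, 2 * (2 ^ s) ^ 2 *
          ((∑' j, eweight (k - j) ^ s * ‖u (k - j)‖ₑ * ‖v j‖ₑ) ^ 2 +
            (∑' j, eweight (k - j) ^ s * ‖v (k - j)‖ₑ * ‖u j‖ₑ) ^ 2) := by
        gcongr with k
        refine (pow_le_pow_left' (eweight_mul_enorm_conv_le hs u v k) 2).trans ?_
        rw [mul_pow, mul_comm 2 ((2 ^ s) ^ 2 : ℝ≥0∞), mul_assoc]
        exact mul_le_mul_right (add_sq_le _ _) _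
    _ ≤ 2 * (2 ^ s) ^ 2 *
          (wenergy s u * ((∑' k : Fin d → ℤ, eweight k ^ (-(2 * r))) * wenergy r v) +
            wenergy s v * ((∑' k : Fin d → ℤ, eweight k ^ (-(2 * r))) * wenergy r u)) := by
        rw [ENNReal.tsum_mul_left, ENNReal.tsum_add]
        gcongr
        exacts [young u v, young v u]
    _ = _ := by ring

end Weight

/-- Tame product estimate for weighted sequence norms (Lemma 2.1, Fourier form),
with `s₀ = ⌊d/2⌋ + 1`. -/
theorem tame_product_estimate (d : ℕ) (hd : 1 ≤ d) (s : ℝ)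
    (hs : ((d / 2 + 1 : ℕ) : ℝ) ≤ s) :
    ∃ C : ℝ, 0 < C ∧ ∀ u v : (Fin d → ℤ) → ℂ,
      WSummable s u → WSummable s v →
      wnorm s (conv u v) ≤
        C * (wnorm s u * wnorm ((d / 2 + 1 : ℕ) : ℝ) v +
             wnorm ((d / 2 + 1 : ℕ) : ℝ) u * wnorm s v) := by
  generalize hr : ((d / 2 + 1 : ℕ) : ℝ) = r at hs ⊢
  have hs0 : 0 ≤ s := le_trans (hr ▸ Nat.cast_nonneg _) hs
  set M : ℝ≥0∞ := 2 * (2 ^ s) ^ 2 * ∑' k : Fin d → ℤ, eweight k ^ (-(2 * r))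
  have hM_top : M ≠ ∞ := by
    have hsum : ∑' k : Fin d → ℤ, eweight k ^ (-(2 * r)) ≠ ∞ :=
      tsum_eweight_rpow_neg_ne_top (n := 2 * (d / 2 + 1)) (by omega) (by rw [← hr]; norm_num)
    have h2 : (2 : ℝ≥0∞) ^ s ≠ ∞ := ENNReal.rpow_ne_top_of_nonneg hs0 ENNReal.ofNat_ne_top
    exact ENNReal.mul_ne_top (ENNReal.mul_ne_top ENNReal.ofNat_ne_top (ENNReal.pow_ne_top h2)) hsum
  refine ⟨√M.toReal + 1, by positivity, fun u v hu hv => ?_⟩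
  have hur : wenergy r u ≠ ∞ := ne_top_of_le_ne_top hu.wenergy_ne_top (wenergy_mono hs u)
  have hvr : wenergy r v ≠ ∞ := ne_top_of_le_ne_top hv.wenergy_ne_top (wenergy_mono hs v)
  have huv := ENNReal.mul_ne_top hu.wenergy_ne_top hvr
  have hvu := ENNReal.mul_ne_top hur hv.wenergy_ne_top
  have key : (wenergy s (conv u v)).toReal ≤ M.toReal *
      ((wenergy s u).toReal * (wenergy r v).toReal +
        (wenergy r u).toReal * (wenergy s v).toReal) := by
    rw [← ENNReal.toReal_mul, ← ENNReal.toReal_mul, ← ENNReal.toReal_add huv hvu,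
      ← ENNReal.toReal_mul]
    exact ENNReal.toReal_mono (ENNReal.mul_ne_top hM_top (ENNReal.add_ne_top.2 ⟨huv, hvu⟩))
      (wenergy_conv_le hs0 r u v)
  have hsqrt (a b : ℝ) (ha : 0 ≤ a) (hb : 0 ≤ b) : √(a + b) ≤ √a + √b := by
    refine Real.sqrt_le_iff.2 ⟨by positivity, ?_⟩
    nlinarith [Real.sq_sqrt ha, Real.sq_sqrt hb,
      mul_nonneg (Real.sqrt_nonneg a) (Real.sqrt_nonneg b)]
  simp_rw [wnorm_eq_sqrt_wenergy]
  rw [← Real.sqrt_mul ENNReal.toReal_nonneg, ← Real.sqrt_mul ENNReal.toReal_nonneg]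
  refine (Real.sqrt_le_sqrt key).trans ?_
  rw [Real.sqrt_mul ENNReal.toReal_nonneg]
  refine mul_le_mul (le_add_of_nonneg_right zero_le_one) ?_ (Real.sqrt_nonneg _)
    (add_nonneg (Real.sqrt_nonneg _) zero_le_one)
  exact hsqrt _ _ (mul_nonneg ENNReal.toReal_nonneg ENNReal.toReal_nonneg)
    (mul_nonneg ENNReal.toReal_nonneg ENNReal.toReal_nonneg)
end

section
/- Algebra (interpolation) property of the block-decay norm (Lemma 2.7): Let ν ≥ 1 and s ≥ s₀. There exists a constant C = C(s, ν) > 0 such that for all Töplitz-in-time 2×2 block operators R, B with |R|_s < ∞ and |B|_s < ∞ one has |R ∘ B|_s ≤ C (|R|_s |B|_{s₀} + |R|_{s₀} |B|_s). -/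
open scoped ENNReal NNReal BigOperators

/-- A Töplitz-in-time `2 × 2` block operator: `R ℓ j j'` is the block coupling the
space modes `±j'` to `±j` at time-Fourier index `ℓ`. -/
abbrev BlockOp (ν : ℕ) := (Fin ν → ℤ) → ℕ+ → ℕ+ → Matrix (Fin 2) (Fin 2) ℂ

/-- The weight `⟨(ℓ, m)⟩^{2s} = max(1, ‖ℓ‖_∞, |m|)^{2s}` as an extended real. -/
noncomputable def bwt (ν : ℕ) (s : ℝ) (ℓ : Fin ν → ℤ) (m : ℤ) : ℝ≥0∞ :=
  ENNReal.ofReal ((max 1 (max ‖ℓ‖ ((|m| : ℤ) : ℝ))) ^ (2 * s))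

/-- The squared Frobenius norm of a `2 × 2` complex matrix, as an extended real. -/
noncomputable def frobSq (M : Matrix (Fin 2) (Fin 2) ℂ) : ℝ≥0∞ :=
  ∑ i : Fin 2, ∑ j : Fin 2, (‖M i j‖₊ : ℝ≥0∞) ^ 2

/-- The block-decay norm
`|R|_s = sup_{j'} (∑_{ℓ, j} ⟨(ℓ, j − j')⟩^{2s} ‖R(ℓ,j,j')‖²)^{1/2}` (valued in `ℝ≥0∞`). -/
noncomputable def blockNorm {ν : ℕ} (s : ℝ) (R : BlockOp ν) : ℝ≥0∞ :=
  ⨆ j' : ℕ+, (∑' ℓ : Fin ν → ℤ, ∑' j : ℕ+,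
    bwt ν s ℓ (((j : ℕ) : ℤ) - ((j' : ℕ) : ℤ)) * frobSq (R ℓ j j')) ^ (1/2 : ℝ)

/-- Composition of Töplitz-in-time block operators:
`(R ∘ B)(ℓ, j, j') = ∑_{ℓ', k} R(ℓ − ℓ', j, k) · B(ℓ', k, j')`. -/
noncomputable def bcomp {ν : ℕ} (R B : BlockOp ν) : BlockOp ν :=
  fun ℓ j j' => ∑' q : (Fin ν → ℤ) × ℕ+, R (ℓ - q.1) j q.2 * B q.1 q.2 j'

/-- `s₀ = ⌊(ν+1)/2⌋ + 1`. -/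
def s0 (ν : ℕ) : ℕ := (ν + 1) / 2 + 1

/-- **Cauchy–Schwarz** with weights, for a possibly non-summable complex series. -/
theorem nnnorm_tsum_sq_le {ι : Type*} (z : ι → ℂ) (w : ι → ℝ≥0∞) (h0 : ∀ i, w i ≠ 0)
    (htop : ∀ i, w i ≠ ⊤) :
    (‖∑' i, z i‖₊ : ℝ≥0∞) ^ 2 ≤ (∑' i, w i * (‖z i‖₊ : ℝ≥0∞) ^ 2) * ∑' i, (w i)⁻¹ := by
  by_cases hz : Summable z
  swap
  · simp [tsum_eq_zero_of_not_summable hz]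
  lift w to ι → ℝ≥0 using htop
  have h0' : ∀ i, w i ≠ 0 := fun i h => h0 i (by simp [h])
  have hlim : Filter.Tendsto (fun t : Finset ι => (‖∑ i ∈ t, z i‖₊ : ℝ≥0∞) ^ 2) Filter.atTop
      (nhds ((‖∑' i, z i‖₊ : ℝ≥0∞) ^ 2)) := by
    have h := (ENNReal.tendsto_coe.2 hz.hasSum.nnnorm)
    exact ((ENNReal.continuous_pow 2).tendsto _).comp h
  refine le_of_tendsto' hlim fun t => ?_
  calc (‖∑ i ∈ t, z i‖₊ : ℝ≥0∞) ^ 2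
      ≤ (((∑ i ∈ t, ‖z i‖₊) ^ 2 : ℝ≥0) : ℝ≥0∞) := by
        rw [← ENNReal.coe_pow, ENNReal.coe_le_coe]
        gcongr
        exact nnnorm_sum_le _ _
    _ ≤ (((∑ i ∈ t, w i * ‖z i‖₊ ^ 2) * ∑ i ∈ t, (w i)⁻¹ : ℝ≥0) : ℝ≥0∞) := by
        rw [ENNReal.coe_le_coe]
        refine Finset.sum_sq_le_sum_mul_sum_of_sq_le_mul t (fun _ _ => zero_le)
          (fun _ _ => zero_le) fun i _ => le_of_eq ?_
        have := h0' i
        field_simp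
    _ = (∑ i ∈ t, (w i : ℝ≥0∞) * (‖z i‖₊ : ℝ≥0∞) ^ 2) * ∑ i ∈ t, (w i : ℝ≥0∞)⁻¹ := by
        push_cast
        congr 1
        exact Finset.sum_congr rfl fun i _ => ENNReal.coe_inv (h0' i)
    _ ≤ _ := by
        gcongr <;> exact ENNReal.sum_le_tsum t

/-- Weighted Cauchy–Schwarz inequality for the Frobenius norm of a series of matrices. -/
theorem frobSq_tsum_le {ι : Type*} (M : ι → Matrix (Fin 2) (Fin 2) ℂ) (w : ι → ℝ≥0∞)
    (h0 : ∀ i, w i ≠ 0) (htop : ∀ i, w i ≠ ⊤) :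
    frobSq (∑' i, M i) ≤ (∑' i, w i * frobSq (M i)) * ∑' i, (w i)⁻¹ := by
  by_cases hM : Summable M
  swap
  · simp [tsum_eq_zero_of_not_summable hM, frobSq]
  have hentry : ∀ a b, (∑' i, M i) a b = ∑' i, M i a b := fun a b => by
    have h1 : Summable fun i => M i a := Pi.summable.1 hM a
    have h2 : (∑' i, M i) a = ∑' i, M i a := tsum_apply hM
    rw [h2]
    exact tsum_apply h1
  have hsum : ∑' i, w i * frobSq (M i)
      = ∑ a : Fin 2, ∑ b : Fin 2, ∑' i, w i * (‖M i a b‖₊ : ℝ≥0∞) ^ 2 := by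
    simp only [frobSq, Fin.sum_univ_two, mul_add, ENNReal.tsum_add]
  rw [hsum, Finset.sum_mul]
  refine Finset.sum_le_sum fun a _ => ?_
  rw [Finset.sum_mul]
  refine Finset.sum_le_sum fun b _ => ?_
  rw [hentry]
  exact nnnorm_tsum_sq_le _ w h0 htop

/-- The Frobenius norm is submultiplicative. -/
theorem frobSq_mul_le (M N : Matrix (Fin 2) (Fin 2) ℂ) :
    frobSq (M * N) ≤ frobSq M * frobSq N := by
  have hcs : ∀ a b, (‖(M * N) a b‖₊ : ℝ≥0∞) ^ 2
      ≤ (∑ k, (‖M a k‖₊ : ℝ≥0∞) ^ 2) * ∑ k, (‖N k b‖₊ : ℝ≥0∞) ^ 2 := fun a b => by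
    have h : ‖(M * N) a b‖₊ ^ 2 ≤ (∑ k, ‖M a k‖₊ ^ 2) * ∑ k, ‖N k b‖₊ ^ 2 := by
      refine le_trans ?_ (Finset.sum_mul_sq_le_sq_mul_sq Finset.univ _ _)
      gcongr
      rw [Matrix.mul_apply]
      exact (nnnorm_sum_le _ _).trans_eq (by simp only [nnnorm_mul])
    exact_mod_cast h
  calc frobSq (M * N)
      ≤ ∑ a : Fin 2, ∑ b : Fin 2,
          (∑ k, (‖M a k‖₊ : ℝ≥0∞) ^ 2) * ∑ k, (‖N k b‖₊ : ℝ≥0∞) ^ 2 :=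
        Finset.sum_le_sum fun a _ => Finset.sum_le_sum fun b _ => hcs a b
    _ = frobSq M * frobSq N := by
        simp only [frobSq, Fin.sum_univ_two]
        ring

theorem bwt_ne_zero (ν : ℕ) (s : ℝ) (ℓ : Fin ν → ℤ) (m : ℤ) : bwt ν s ℓ m ≠ 0 := by
  rw [bwt, ne_eq, ENNReal.ofReal_eq_zero, not_le]
  positivity

theorem bwt_ne_top (ν : ℕ) (s : ℝ) (ℓ : Fin ν → ℤ) (m : ℤ) : bwt ν s ℓ m ≠ ⊤ :=
  ENNReal.ofReal_ne_top

/-- Quasi-subadditivity of the weight. -/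
theorem bwt_add_le (ν : ℕ) {s : ℝ} (hs : 0 ≤ s) (ℓ ℓ' : Fin ν → ℤ) (m m' : ℤ) :
    bwt ν s (ℓ + ℓ') (m + m')
      ≤ ENNReal.ofReal (2 ^ (2 * s)) * (bwt ν s ℓ m + bwt ν s ℓ' m') := by
  unfold bwt
  set x : ℝ := max 1 (max ‖ℓ‖ ((|m| : ℤ) : ℝ))
  set y : ℝ := max 1 (max ‖ℓ'‖ ((|m'| : ℤ) : ℝ))
  have hx1 : 1 ≤ x := le_max_left _ _
  have hy1 : 1 ≤ y := le_max_left _ _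
  have hxℓ : ‖ℓ‖ ≤ x := (le_max_left _ _).trans (le_max_right _ _)
  have hyℓ : ‖ℓ'‖ ≤ y := (le_max_left _ _).trans (le_max_right _ _)
  have hxm : ((|m| : ℤ) : ℝ) ≤ x := (le_max_right _ _).trans (le_max_right _ _)
  have hym : ((|m'| : ℤ) : ℝ) ≤ y := (le_max_right _ _).trans (le_max_right _ _)
  have hm : ((|m + m'| : ℤ) : ℝ) ≤ ((|m| : ℤ) : ℝ) + ((|m'| : ℤ) : ℝ) := by
    exact_mod_cast abs_add_le m m'
  have hℓ : ‖ℓ + ℓ'‖ ≤ ‖ℓ‖ + ‖ℓ'‖ := norm_add_le _ _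
  have hadd : max 1 (max ‖ℓ + ℓ'‖ ((|m + m'| : ℤ) : ℝ)) ≤ 2 * max x y := by
    have h1 : x ≤ max x y := le_max_left _ _
    have h2 : y ≤ max x y := le_max_right _ _
    refine max_le ?_ (max_le ?_ ?_) <;> linarith
  have hmax : (max x y) ^ (2 * s) ≤ x ^ (2 * s) + y ^ (2 * s) := by
    have hxs : 0 ≤ x ^ (2 * s) := by positivity
    have hys : 0 ≤ y ^ (2 * s) := by positivity
    rcases max_choice x y with h | h <;> rw [h] <;> linarith
  rw [← ENNReal.ofReal_add (by positivity) (by positivity), ← ENNReal.ofReal_mul (by positivity)]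
  refine ENNReal.ofReal_le_ofReal ?_
  calc (max 1 (max ‖ℓ + ℓ'‖ ((|m + m'| : ℤ) : ℝ))) ^ (2 * s)
      ≤ (2 * max x y) ^ (2 * s) := by gcongr
    _ = 2 ^ (2 * s) * (max x y) ^ (2 * s) := Real.mul_rpow (by norm_num) (by positivity)
    _ ≤ _ := by gcongr

/-- The inverse weight is summable over `ℤ^(ν+1)` beyond the critical exponent. -/
theorem tsum_bwt_inv_lt_top (ν : ℕ) {s : ℝ} (hs : (ν : ℝ) + 1 < 2 * s) :
    ∑' p : (Fin ν → ℤ) × ℤ, (bwt ν s p.1 p.2)⁻¹ < ⊤ := by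
  let b := (Pi.basisFun ℝ (Fin ν)).prod (Module.Basis.singleton Unit ℝ)
  let L : Submodule ℤ ((Fin ν → ℝ) × ℝ) := Submodule.span ℤ (Set.range b)
  have hmem : ∀ p : (Fin ν → ℤ) × ℤ, ((fun i => (p.1 i : ℝ), (p.2 : ℝ)) : (Fin ν → ℝ) × ℝ)
      ∈ L := by
    intro p
    rw [b.mem_span_iff_repr_mem ℤ]
    rintro (i | i) <;> simp [b]
  let e : (Fin ν → ℤ) × ℤ → L := fun p => ⟨_, hmem p⟩
  have he : Function.Injective e := by
    intro p p' h
    simp only [e, Subtype.mk.injEq, Prod.mk.injEq, funext_iff, Int.cast_inj] at h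
    exact Prod.ext (funext h.1) h.2
  have hnorm : ∀ p, ‖e p‖ = max ‖p.1‖ ((|p.2| : ℤ) : ℝ) := by
    intro p
    simp only [e, Submodule.coe_norm, Prod.norm_mk, Int.cast_abs, Real.norm_eq_abs]
    congr 1
  have hrank : Module.finrank ℤ L = ν + 1 := by
    rw [ZLattice.rank ℝ L]
    simp
  have hsum : Summable fun p => ‖e p‖ ^ (-(2 * s)) :=
    (ZLattice.summable_norm_rpow L (-(2 * s))
      (by rw [hrank]; push_cast; linarith)).comp_injective he
  have hle : ∀ p : (Fin ν → ℤ) × ℤ, (bwt ν s p.1 p.2)⁻¹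
      ≤ ENNReal.ofReal (‖e p‖ ^ (-(2 * s))) + if p = 0 then 1 else 0 := by
    intro p
    rw [bwt, ← ENNReal.ofReal_inv_of_pos (by positivity), ← Real.rpow_neg (by positivity), ← hnorm]
    by_cases hp : p = 0
    · rw [if_pos hp]
      refine le_trans ?_ le_add_self
      rw [ENNReal.ofReal_le_one]
      exact Real.rpow_le_one_of_one_le_of_nonpos (le_max_left _ _)
        (by linarith [(Nat.cast_nonneg ν : (0 : ℝ) ≤ ν)])
    · rw [if_neg hp, add_zero, max_eq_right]
      rw [hnorm]
      by_cases h2 : p.2 = 0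
      · have h1 : p.1 ≠ 0 := fun h1 => hp (Prod.ext h1 h2)
        obtain ⟨i, hi⟩ := Function.ne_iff.1 h1
        refine le_trans ?_ ((norm_le_pi_norm p.1 i).trans (le_max_left _ _))
        rw [Int.norm_eq_abs]
        exact_mod_cast Int.one_le_abs hi
      · refine le_trans ?_ (le_max_right _ _)
        exact_mod_cast Int.one_le_abs h2
  refine (ENNReal.tsum_le_tsum hle).trans_lt ?_
  rw [ENNReal.tsum_add, tsum_ite_eq]
  exact ENNReal.add_lt_top.2 ⟨hsum.tsum_ofReal_lt_top, ENNReal.one_lt_top⟩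

/-- Each column of `R` is controlled by the block-decay norm, also after a shift in time. -/
theorem tsum_column_le_blockNorm_sq {ν : ℕ} (s : ℝ) (R : BlockOp ν) (ℓ₀ : Fin ν → ℤ) (k : ℕ+) :
    ∑' ℓ : Fin ν → ℤ, ∑' j : ℕ+, bwt ν s (ℓ - ℓ₀) (((j : ℕ) : ℤ) - ((k : ℕ) : ℤ)) *
      frobSq (R (ℓ - ℓ₀) j k) ≤ blockNorm s R ^ 2 := by
  refine ((Equiv.subRight ℓ₀).tsum_eq (fun ℓ : Fin ν → ℤ => ∑' j : ℕ+,
    bwt ν s ℓ (((j : ℕ) : ℤ) - ((k : ℕ) : ℤ)) * frobSq (R ℓ j k))).trans_le ?_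
  have h := le_iSup (fun j' : ℕ+ => (∑' ℓ : Fin ν → ℤ, ∑' j : ℕ+,
    bwt ν s ℓ (((j : ℕ) : ℤ) - ((j' : ℕ) : ℤ)) * frobSq (R ℓ j j')) ^ (1/2 : ℝ)) k
  refine le_trans (le_of_eq ?_) (pow_le_pow_left' h 2)
  rw [← ENNReal.rpow_natCast, ← ENNReal.rpow_mul]
  norm_num

/-- A double sum factorizes along the intermediate mode of a composition. -/
theorem tsum_comp_le {ν : ℕ} (s t : ℝ) (R B : BlockOp ν) (j' : ℕ+) :
    ∑' ℓ : Fin ν → ℤ, ∑' j : ℕ+, ∑' q : (Fin ν → ℤ) × ℕ+,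
      (bwt ν s (ℓ - q.1) (((j : ℕ) : ℤ) - ((q.2 : ℕ) : ℤ)) * frobSq (R (ℓ - q.1) j q.2)) *
      (bwt ν t q.1 (((q.2 : ℕ) : ℤ) - ((j' : ℕ) : ℤ)) * frobSq (B q.1 q.2 j'))
      ≤ blockNorm s R ^ 2 * blockNorm t B ^ 2 := by
  have hcomm : ∀ F : (Fin ν → ℤ) → ℕ+ → (Fin ν → ℤ) × ℕ+ → ℝ≥0∞,
      ∑' ℓ, ∑' j, ∑' q, F ℓ j q = ∑' q, ∑' ℓ, ∑' j, F ℓ j q := fun F => by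
    rw [ENNReal.tsum_comm (α := (Fin ν → ℤ) × ℕ+)]
    exact tsum_congr fun ℓ => ENNReal.tsum_comm
  rw [hcomm]
  simp only [ENNReal.tsum_mul_right]
  calc _ ≤ ∑' q : (Fin ν → ℤ) × ℕ+, blockNorm s R ^ 2 *
        (bwt ν t q.1 (((q.2 : ℕ) : ℤ) - ((j' : ℕ) : ℤ)) * frobSq (B q.1 q.2 j')) :=
        ENNReal.tsum_le_tsum fun q => by
          gcongr
          exact tsum_column_le_blockNorm_sq s R q.1 q.2
    _ ≤ _ := by
        have hB := tsum_column_le_blockNorm_sq t B 0 j'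
        simp only [sub_zero] at hB
        rw [ENNReal.tsum_mul_left, ENNReal.tsum_prod']
        gcongr

/-- The pointwise bound behind the interpolation inequality. -/
theorem mul_inv_mul_add_mul_le {a b x y c u : ℝ≥0∞} (ha : a ≠ 0) (ha' : a ≠ ⊤) (hb : b ≠ 0)
    (hb' : b ≠ ⊤) (hu : u ≤ c * (a + b)) :
    u * (a * y + x * b)⁻¹ ≤ c * (y⁻¹ + x⁻¹) := by
  have h1 : a * (a * y + x * b)⁻¹ ≤ y⁻¹ := by
    calc a * (a * y + x * b)⁻¹ ≤ a * (a * y)⁻¹ := by gcongr; exact le_self_add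
      _ = y⁻¹ := by
        rw [ENNReal.mul_inv (Or.inl ha) (Or.inl ha'), ← mul_assoc, ENNReal.mul_inv_cancel ha ha',
          one_mul]
  have h2 : b * (a * y + x * b)⁻¹ ≤ x⁻¹ := by
    calc b * (a * y + x * b)⁻¹ ≤ b * (b * x)⁻¹ := by
          gcongr
          rw [mul_comm b x]
          exact le_add_self
      _ = x⁻¹ := by
        rw [ENNReal.mul_inv (Or.inl hb) (Or.inl hb'), ← mul_assoc, ENNReal.mul_inv_cancel hb hb',
          one_mul]
  calc u * (a * y + x * b)⁻¹ ≤ c * (a + b) * (a * y + x * b)⁻¹ := by gcongr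
    _ = c * (a * (a * y + x * b)⁻¹ + b * (a * y + x * b)⁻¹) := by ring
    _ ≤ _ := by gcongr

/-- Algebra (interpolation) property of the block-decay norm (Lemma 2.7):
`|R ∘ B|_s ≤ C(s, ν) (|R|_s |B|_{s₀} + |R|_{s₀} |B|_s)`. -/
theorem blockNorm_comp (ν : ℕ) (hν : 1 ≤ ν) (s : ℝ) (hs : ((s0 ν : ℕ) : ℝ) ≤ s) :
    ∃ C : ℝ≥0∞, 0 < C ∧ C < ⊤ ∧ ∀ R B : BlockOp ν,
      blockNorm s R < ⊤ → blockNorm s B < ⊤ →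
      blockNorm s (bcomp R B) ≤
        C * (blockNorm s R * blockNorm ((s0 ν : ℕ) : ℝ) B +
             blockNorm ((s0 ν : ℕ) : ℝ) R * blockNorm s B) := by
  set t : ℝ := ((s0 ν : ℕ) : ℝ) with ht
  have ht2 : (ν : ℝ) + 1 < 2 * t := by
    have : ν + 1 < 2 * s0 ν := by unfold s0; omega
    rw [ht]
    exact_mod_cast this
  have hs0 : 0 ≤ s := le_trans (Nat.cast_nonneg _) hs
  set K := ∑' p : (Fin ν → ℤ) × ℤ, (bwt ν t p.1 p.2)⁻¹
  have hKtop : K < ⊤ := tsum_bwt_inv_lt_top ν ht2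
  set c := ENNReal.ofReal (2 ^ (2 * s))
  set D := c * (K + K) + 1 with hD
  have hDtop : D < ⊤ :=
    ENNReal.add_lt_top.2 ⟨ENNReal.mul_lt_top ENNReal.ofReal_lt_top
      (ENNReal.add_lt_top.2 ⟨hKtop, hKtop⟩), ENNReal.one_lt_top⟩
  refine ⟨D ^ (1 / 2 : ℝ), ENNReal.rpow_pos (by simp [hD]) hDtop.ne,
    ENNReal.rpow_lt_top_of_nonneg (by norm_num) hDtop.ne, fun R B _ _ => ?_⟩
  refine iSup_le fun j' => ?_
  set P := blockNorm s R * blockNorm t B with hP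
  set Q := blockNorm t R * blockNorm s B with hQ
  let W : (Fin ν → ℤ) → ℕ+ → (Fin ν → ℤ) × ℕ+ → ℝ≥0∞ := fun ℓ j q =>
    bwt ν s (ℓ - q.1) (((j : ℕ) : ℤ) - ((q.2 : ℕ) : ℤ)) *
      bwt ν t q.1 (((q.2 : ℕ) : ℤ) - ((j' : ℕ) : ℤ)) +
    bwt ν t (ℓ - q.1) (((j : ℕ) : ℤ) - ((q.2 : ℕ) : ℤ)) *
      bwt ν s q.1 (((q.2 : ℕ) : ℤ) - ((j' : ℕ) : ℤ))
  have hW0 : ∀ ℓ j q, W ℓ j q ≠ 0 := fun ℓ j q => by simp [W, bwt_ne_zero]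
  have hWtop : ∀ ℓ j q, W ℓ j q ≠ ⊤ := fun ℓ j q => by
    simp [W, ENNReal.mul_eq_top, bwt_ne_top]
  have hinv : ∀ (ℓ : Fin ν → ℤ) (j : ℕ+), bwt ν s ℓ (((j : ℕ) : ℤ) - ((j' : ℕ) : ℤ)) *
      ∑' q, (W ℓ j q)⁻¹ ≤ D := fun ℓ j => by
    have hy : ∑' q : (Fin ν → ℤ) × ℕ+,
        (bwt ν t q.1 (((q.2 : ℕ) : ℤ) - ((j' : ℕ) : ℤ)))⁻¹ ≤ K := by
      refine ENNReal.tsum_comp_le_tsum_of_injective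
        (f := fun q : (Fin ν → ℤ) × ℕ+ => (q.1, ((q.2 : ℕ) : ℤ) - ((j' : ℕ) : ℤ))) ?_
        (fun p : (Fin ν → ℤ) × ℤ => (bwt ν t p.1 p.2)⁻¹)
      rintro ⟨p, k⟩ ⟨p', k'⟩ h
      simpa using h
    have hx : ∑' q : (Fin ν → ℤ) × ℕ+,
        (bwt ν t (ℓ - q.1) (((j : ℕ) : ℤ) - ((q.2 : ℕ) : ℤ)))⁻¹ ≤ K := by
      refine ENNReal.tsum_comp_le_tsum_of_injective
        (f := fun q : (Fin ν → ℤ) × ℕ+ => (ℓ - q.1, ((j : ℕ) : ℤ) - ((q.2 : ℕ) : ℤ))) ?_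
        (fun p : (Fin ν → ℤ) × ℤ => (bwt ν t p.1 p.2)⁻¹)
      rintro ⟨p, k⟩ ⟨p', k'⟩ h
      simpa using h
    rw [← ENNReal.tsum_mul_left]
    refine le_trans (ENNReal.tsum_le_tsum fun q => mul_inv_mul_add_mul_le (c := c)
      (bwt_ne_zero _ _ _ _) (bwt_ne_top _ _ _ _) (bwt_ne_zero _ _ _ _) (bwt_ne_top _ _ _ _) ?_) ?_
    · simpa using bwt_add_le ν hs0 (ℓ - q.1) q.1 (((j : ℕ) : ℤ) - ((q.2 : ℕ) : ℤ))
        (((q.2 : ℕ) : ℤ) - ((j' : ℕ) : ℤ))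
    · rw [ENNReal.tsum_mul_left, ENNReal.tsum_add]
      refine le_trans ?_ le_self_add
      gcongr
  have hterm : ∀ (ℓ : Fin ν → ℤ) (j : ℕ+),
      bwt ν s ℓ (((j : ℕ) : ℤ) - ((j' : ℕ) : ℤ)) * frobSq (bcomp R B ℓ j j') ≤
      D * ∑' q, W ℓ j q * (frobSq (R (ℓ - q.1) j q.2) * frobSq (B q.1 q.2 j')) := fun ℓ j => by
    calc _ ≤ bwt ν s ℓ (((j : ℕ) : ℤ) - ((j' : ℕ) : ℤ)) *
          ((∑' q, W ℓ j q * frobSq (R (ℓ - q.1) j q.2 * B q.1 q.2 j')) * ∑' q, (W ℓ j q)⁻¹) := by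
          gcongr
          exact frobSq_tsum_le _ _ (hW0 ℓ j) (hWtop ℓ j)
      _ = (bwt ν s ℓ (((j : ℕ) : ℤ) - ((j' : ℕ) : ℤ)) * ∑' q, (W ℓ j q)⁻¹) *
          ∑' q, W ℓ j q * frobSq (R (ℓ - q.1) j q.2 * B q.1 q.2 j') := by ring
      _ ≤ _ := by
          gcongr with q
          · exact hinv ℓ j
          · exact frobSq_mul_le _ _
  have hsum : ∑' ℓ : Fin ν → ℤ, ∑' j : ℕ+,
      bwt ν s ℓ (((j : ℕ) : ℤ) - ((j' : ℕ) : ℤ)) * frobSq (bcomp R B ℓ j j') ≤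
      D * (P + Q) ^ 2 := by
    calc _ ≤ ∑' (ℓ : Fin ν → ℤ) (j : ℕ+),
          D * ∑' q, W ℓ j q * (frobSq (R (ℓ - q.1) j q.2) * frobSq (B q.1 q.2 j')) :=
          ENNReal.tsum_le_tsum fun ℓ => ENNReal.tsum_le_tsum fun j => hterm ℓ j
      _ ≤ D * (P ^ 2 + Q ^ 2) := by
          simp only [ENNReal.tsum_mul_left]
          gcongr
          rw [hP, hQ, mul_pow, mul_pow]
          refine le_trans (le_of_eq ?_)
            (add_le_add (tsum_comp_le s t R B j') (tsum_comp_le t s R B j'))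
          simp only [← ENNReal.tsum_add]
          refine tsum_congr fun ℓ => tsum_congr fun j => tsum_congr fun q => ?_
          simp only [W]
          ring
      _ ≤ _ := by
          gcongr
          rw [add_sq']
          exact le_self_add
  calc _ ≤ (D * (P + Q) ^ 2) ^ (1 / 2 : ℝ) := ENNReal.rpow_le_rpow hsum (by norm_num)
    _ = _ := by
      rw [ENNReal.mul_rpow_of_nonneg _ _ (by norm_num), ← ENNReal.rpow_natCast,
        ← ENNReal.rpow_mul]
      norm_num
end
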